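/- Let γ : [0,1] → ℝ^d be a Lipschitz curve, regarded as a multiple curve with one component, and let 0 ≤ s < t ≤ 1. Let γ' be the multiple curve with two components obtained by restricting γ to [0,s] and to [t,1] (each reparametrized affinely over [0,1]). Then E(γ') ≥ E(γ) + λ₁ (λ₂ − Var(γ; [s,t])). In particular, if Var(γ; [s,t]) < λ₂, then E(γ') > E(γ): removing a sub-arc of total variation less than λ₂ strictly increases the MPPC energy. -/

import Mathlib

open MeasureTheory Metric Set

noncomputable section

/-- A multiple curve: a finite family of Lipschitz curves `[0,1] → ℝ^d`. -/
structure MultiCurve (d : ℕ) where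
  k : ℕ
  hk : 1 ≤ k
  curves : Fin k → ℝ → EuclideanSpace ℝ (Fin d)
  lipschitz : ∀ i, ∃ C : NNReal, LipschitzOnWith C (curves i) (Set.Icc 0 1)

/-- The image `Γ` of a multiple curve. -/
def MultiCurve.image {d : ℕ} (γ : MultiCurve d) : Set (EuclideanSpace ℝ (Fin d)) :=
  ⋃ i, γ.curves i '' Set.Icc 0 1

/-- The total length of a multiple curve: sum of total variations over `[0,1]`. -/
def MultiCurve.length {d : ℕ} (γ : MultiCurve d) : ℝ :=
  ∑ i, (eVariationOn (γ.curves i) (Set.Icc 0 1)).toReal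

/-- The MPPC energy. -/
def mppcEnergy {d : ℕ} (μ : Measure (EuclideanSpace ℝ (Fin d))) (p lam₁ lam₂ : ℝ)
    (γ : MultiCurve d) : ℝ :=
  (∫ x, Metric.infDist x γ.image ^ p ∂μ) + lam₁ * (γ.length + lam₂ * ((γ.k : ℝ) - 1))

/-- The support of a measure: points all of whose neighborhoods have positive measure. -/
def msupport {d : ℕ} (μ : Measure (EuclideanSpace ℝ (Fin d))) : Set (EuclideanSpace ℝ (Fin d)) :=
  {x | ∀ ε > 0, 0 < μ (Metric.ball x ε)}

end

/-- The affine reparametrization of `[a, b]` over `[0, 1]` is onto. -/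
theorem image_affine_Icc {a b : ℝ} (hab : a ≤ b) :
    (fun u : ℝ => a + (b - a) * u) '' Icc 0 1 = Icc a b := by
  rw [← segment_eq_Icc hab, segment_eq_image']
  simp only [smul_eq_mul, mul_comm]

/-- Total variation is invariant under affine reparametrization over `[0, 1]`. -/
theorem eVariationOn_affine {E : Type*} [PseudoEMetricSpace E] (f : ℝ → E) {a b : ℝ}
    (hab : a ≤ b) :
    eVariationOn (fun u => f (a + (b - a) * u)) (Icc 0 1) = eVariationOn f (Icc a b) := by
  have hmono : MonotoneOn (fun u : ℝ => a + (b - a) * u) (Icc 0 1) := fun x _ y _ hxy => by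
    have := mul_le_mul_of_nonneg_left hxy (sub_nonneg.2 hab)
    simpa using this
  rw [← image_affine_Icc hab, ← eVariationOn.comp_eq_of_monotoneOn f _ hmono]
  rfl

/-- A curve that is Lipschitz on `[0, 1]` has finite variation there. -/
theorem eVariationOn_Icc_ne_top {E : Type*} [PseudoEMetricSpace E] {f : ℝ → E}
    {C : NNReal} (hf : LipschitzOnWith C f (Icc 0 1)) :
    eVariationOn f (Icc 0 1) ≠ ⊤ := by
  have h := hf.locallyBoundedVariationOn 0 1 (by simp) (by simp)
  simpa [BoundedVariationOn] using h

/-- A measure vanishes off its support. -/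
theorem ae_mem_msupport {d : ℕ} (μ : Measure (EuclideanSpace ℝ (Fin d))) :
    ∀ᵐ x ∂μ, x ∈ msupport μ := by
  refine measure_null_of_locally_null _ fun x hx => ?_
  have hx : ¬ ∀ ε > 0, 0 < μ (ball x ε) := hx
  push Not at hx
  obtain ⟨ε, hε, h⟩ := hx
  exact ⟨ball x ε, mem_nhdsWithin_of_mem_nhds (ball_mem_nhds x hε), le_antisymm h zero_le⟩

/-- The fidelity integrand is integrable when the support is compact. -/
theorem integrable_infDist_rpow {d : ℕ} (μ : Measure (EuclideanSpace ℝ (Fin d)))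
    [IsFiniteMeasure μ] (hcs : IsCompact (msupport μ)) {p : ℝ} (hp : 0 ≤ p)
    (S : Set (EuclideanSpace ℝ (Fin d))) :
    Integrable (fun x => infDist x S ^ p) μ := by
  have hcont : Continuous fun x => infDist x S ^ p :=
    (continuous_infDist_pt S).rpow_const fun _ => Or.inr hp
  rw [← Measure.restrict_eq_self_of_ae_mem (ae_mem_msupport μ)]
  exact hcont.continuousOn.integrableOn_compact hcs

/-- The fidelity term decreases when the set grows. -/
theorem integral_infDist_rpow_anti {d : ℕ} (μ : Measure (EuclideanSpace ℝ (Fin d)))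
    [IsFiniteMeasure μ] (hcs : IsCompact (msupport μ)) {p : ℝ} (hp : 0 ≤ p)
    {S T : Set (EuclideanSpace ℝ (Fin d))} (hST : S ⊆ T) (hS : S.Nonempty) :
    ∫ x, infDist x T ^ p ∂μ ≤ ∫ x, infDist x S ^ p ∂μ :=
  integral_mono (integrable_infDist_rpow μ hcs hp T) (integrable_infDist_rpow μ hcs hp S)
    fun _ => Real.rpow_le_rpow infDist_nonneg (infDist_le_infDist_of_subset hST hS) hp

/-- Removing a sub-arc `γ([s,t])` from a single curve (splitting it into the two restricted
curves, affinely reparametrized over `[0,1]`) increases the MPPC energy by at least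
`λ₁ (λ₂ − Var(γ;[s,t]))`; in particular, if `Var(γ;[s,t]) < λ₂`, the energy strictly
increases. -/
theorem mppc_energy_disconnect (d : ℕ) (hd : 2 ≤ d) (p lam₁ lam₂ : ℝ)
    (hp : 1 ≤ p) (hlam₁ : 0 < lam₁) (hlam₂ : 0 < lam₂)
    (μ : Measure (EuclideanSpace ℝ (Fin d))) [IsFiniteMeasure μ]
    (hcs : IsCompact (msupport μ)) (hpos : 0 < μ Set.univ)
    (γ γ' : MultiCurve d) (hγk : γ.k = 1)
    (s t : ℝ) (hs : 0 ≤ s) (hst : s < t) (ht : t ≤ 1)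
    (hk' : γ'.k = 2)
    (hc0 : γ'.curves ⟨0, γ'.hk⟩ = fun u => γ.curves ⟨0, γ.hk⟩ (s * u))
    (hc1 : γ'.curves ⟨1, by omega⟩ = fun u => γ.curves ⟨0, γ.hk⟩ (t + (1 - t) * u)) :
    mppcEnergy μ p lam₁ lam₂ γ
        + lam₁ * (lam₂ - (eVariationOn (γ.curves ⟨0, γ.hk⟩) (Set.Icc s t)).toReal)
      ≤ mppcEnergy μ p lam₁ lam₂ γ' ∧
    ((eVariationOn (γ.curves ⟨0, γ.hk⟩) (Set.Icc s t)).toReal < lam₂ →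
      mppcEnergy μ p lam₁ lam₂ γ < mppcEnergy μ p lam₁ lam₂ γ') := by
  obtain ⟨k, hk, c, hc⟩ := γ
  obtain ⟨k', hk1, c', hc'⟩ := γ'
  dsimp only at hγk hk' hc0 hc1
  subst hγk hk'
  set f := c ⟨0, hk⟩ with hf
  have h0 : c' 0 = fun u => f (0 + (s - 0) * u) := by simpa using hc0
  have h1 : c' 1 = fun u => f (t + (1 - t) * u) := hc1
  have himg : (⟨1, hk, c, hc⟩ : MultiCurve d).image = f '' Icc 0 1 := by
    ext x
    simp [MultiCurve.image, hf]
  have himg' : (⟨2, hk1, c', hc'⟩ : MultiCurve d).image = f '' Icc 0 s ∪ f '' Icc t 1 := by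
    rw [← image_affine_Icc hs, ← image_affine_Icc ht, image_image, image_image, ← h0, ← h1]
    ext x
    simp [MultiCurve.image, Fin.exists_fin_two]
  have hint : ∫ x, infDist x (⟨1, hk, c, hc⟩ : MultiCurve d).image ^ p ∂μ
      ≤ ∫ x, infDist x (⟨2, hk1, c', hc'⟩ : MultiCurve d).image ^ p ∂μ := by
    rw [himg, himg']
    refine integral_infDist_rpow_anti μ hcs (by linarith) (union_subset ?_ ?_)
      ((nonempty_Icc.2 hs).image f).inl
    · exact image_mono (Icc_subset_Icc_right (hst.le.trans ht))
    · exact image_mono (Icc_subset_Icc_left (hs.trans hst.le))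
  obtain ⟨C, hC⟩ := hc ⟨0, hk⟩
  have hfin : ∀ {a b : ℝ}, 0 ≤ a → b ≤ 1 → eVariationOn f (Icc a b) ≠ ⊤ := fun ha hb =>
    ne_top_of_le_ne_top (eVariationOn_Icc_ne_top hC) (eVariationOn.mono f (Icc_subset_Icc ha hb))
  have hvar : (eVariationOn f (Icc 0 1)).toReal = (eVariationOn f (Icc 0 s)).toReal
      + (eVariationOn f (Icc s t)).toReal + (eVariationOn f (Icc t 1)).toReal := by
    have e1 := eVariationOn.Icc_add_Icc f (s := univ) hs hst.le (mem_univ _)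
    have e2 := eVariationOn.Icc_add_Icc f (s := univ) (hs.trans hst.le) ht (mem_univ _)
    simp only [univ_inter] at e1 e2
    rw [← e2, ← e1, ENNReal.toReal_add, ENNReal.toReal_add]
    · exact hfin le_rfl (hst.le.trans ht)
    · exact hfin hs ht
    · rw [e1]
      exact hfin le_rfl ht
    · exact hfin (hs.trans hst.le) le_rfl
  have hlen : (⟨1, hk, c, hc⟩ : MultiCurve d).length = (eVariationOn f (Icc 0 1)).toReal := by
    simp [MultiCurve.length, hf]
  have hlen' : (⟨2, hk1, c', hc'⟩ : MultiCurve d).length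
      = (eVariationOn f (Icc 0 s)).toReal + (eVariationOn f (Icc t 1)).toReal := by
    simp only [MultiCurve.length, Fin.sum_univ_two]
    rw [h0, h1, eVariationOn_affine f hs, eVariationOn_affine f ht]
  have hmain : mppcEnergy μ p lam₁ lam₂ ⟨1, hk, c, hc⟩
      + lam₁ * (lam₂ - (eVariationOn f (Icc s t)).toReal)
      ≤ mppcEnergy μ p lam₁ lam₂ ⟨2, hk1, c', hc'⟩ := by
    simp only [mppcEnergy, hlen, hlen', hvar]
    push_cast
    linarith
  refine ⟨hmain, fun hlt => ?_⟩
  have := mul_pos hlam₁ (sub_pos.2 hlt)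
  linarith
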